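/- Let κ be a nonzero complex number, l a positive integer, and b an integer with 0 ≤ b ≤ l. Then there exists a Laurent polynomial F in the l+2 variables x₁,…,x_l, y, w with complex coefficients such that for all complex numbers t₁,…,t_l, z, m with (t_u−t_v)/κ ∉ ℤ for all u ≠ v, one has P_{l−b,b}(t,z;m) = F(e^{πi t₁/κ},…,e^{πi t_l/κ}, e^{πi z/κ}, e^{πi m/κ}). (That is, the function P_{l−b,b}(t,z;m) is a trigonometric polynomial in t₁,…,t_l, z, m.) -/

import Mathlib

open Complex Real Finset

/-- Symmetrization: `Sym f(t₁,…,t_l) = Σ_{σ ∈ S_l} f(t_{σ(1)},…,t_{σ(l)})`. -/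
noncomputable def SymSum {l : ℕ} (f : (Fin l → ℂ) → ℂ) (t : Fin l → ℂ) : ℂ :=
  ∑ σ : Equiv.Perm (Fin l), f (t ∘ σ)

/-- The trigonometric weight function `P_{l−b,b}(t,z;m)`. -/
noncomputable def PWeight (κ : ℂ) {l : ℕ} (b : ℕ) (t : Fin l → ℂ) (z m : ℂ) : ℂ :=
  Complex.exp ((π : ℂ) * Complex.I * (b : ℂ) * z / κ) *
  SymSum (fun s =>
    (∏ u ∈ Finset.univ.filter (fun u : Fin l => (u : ℕ) < l - b),
        Complex.sin ((π : ℂ) * (s u - z + m) / κ)) *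
    (∏ u ∈ Finset.univ.filter (fun u : Fin l => l - b ≤ (u : ℕ)),
        Complex.sin ((π : ℂ) * s u / κ)) *
    ∏ u, ∏ v ∈ Finset.Ioi u,
      Complex.sin ((π : ℂ) * (s u - s v - 1) / κ) / Complex.sin ((π : ℂ) * (s u - s v) / κ)) t

namespace MvPolynomial

variable {σ : Type*} {K : Type*} [Field K]

theorem irreducible_X_sub_X {a b : σ} (hab : a ≠ b) :
    Irreducible (X a - X b : MvPolynomial σ K) := by
  classical
  have hcoeff : coeff (Finsupp.single a 1) (X a - X b : MvPolynomial σ K) = 1 := by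
    rw [coeff_sub, coeff_X, coeff_X, if_pos rfl, if_neg, sub_zero]
    simpa [Finsupp.single_left_inj] using hab.symm
  have hne : (X a - X b : MvPolynomial σ K) ≠ 0 := by
    intro h
    simp [h] at hcoeff
  refine irreducible_of_totalDegree_eq_one
    (((isHomogeneous_X K a).sub (isHomogeneous_X K b)).totalDegree hne) fun x hx => ?_
  have := hx (Finsupp.single a 1)
  rw [hcoeff] at this
  exact isUnit_of_dvd_one this

/-- Two differences of variables with distinct underlying pairs are relatively prime. -/
theorem isRelPrime_X_sub_X {a b c d : σ} (hab : a ≠ b) (hcd : c ≠ d)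
    (h : (c ≠ a ∧ c ≠ b) ∨ (d ≠ a ∧ d ≠ b)) :
    IsRelPrime (X a - X b : MvPolynomial σ K) (X c - X d) := by
  classical
  rw [(irreducible_X_sub_X hab).isRelPrime_iff_not_dvd]
  rintro ⟨r, hr⟩
  rcases h with ⟨h₁, h₂⟩ | ⟨h₁, h₂⟩
  · have := congrArg (eval (Pi.single c (1 : K))) hr
    simp [h₁.symm, h₂.symm, hcd.symm] at this
  · have := congrArg (eval (Pi.single d (1 : K))) hr
    simp [h₁.symm, h₂.symm, hcd] at this

/-- A polynomial changing sign when two variables are swapped is divisible by their difference. -/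
theorem X_sub_X_dvd_of_rename_swap [DecidableEq σ] [NeZero (2 : K)] {a b : σ}
    {f : MvPolynomial σ K} (hf : rename (Equiv.swap a b) f = -f) :
    (X a - X b : MvPolynomial σ K) ∣ f := by
  set J : Ideal (MvPolynomial σ K) := Ideal.span {X a - X b}
  have hX : Ideal.Quotient.mkₐ K J (X a) = Ideal.Quotient.mkₐ K J (X b) :=
    Ideal.Quotient.eq.2 (Ideal.subset_span rfl)
  have hcomp : (Ideal.Quotient.mkₐ K J).comp (rename (Equiv.swap a b)) =
      Ideal.Quotient.mkₐ K J := by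
    ext i
    simp only [AlgHom.comp_apply, rename_X]
    rcases eq_or_ne i a with rfl | hia
    · rw [Equiv.swap_apply_left, hX]
    rcases eq_or_ne i b with rfl | hib
    · rw [Equiv.swap_apply_right, hX]
    rw [Equiv.swap_apply_of_ne_of_ne hia hib]
  have h := DFunLike.congr_fun hcomp f
  rw [AlgHom.comp_apply, hf, map_neg] at h
  have h₂ : (2 : K) • Ideal.Quotient.mkₐ K J f = 0 := by
    rw [two_smul]
    nth_rw 1 [← h]
    exact neg_add_cancel _
  have h₀ : Ideal.Quotient.mkₐ K J (C 2⁻¹ * (C 2 * f)) = 0 := by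
    rw [map_mul, ← smul_eq_C_mul, map_smul, h₂, mul_zero]
  rw [← mul_assoc, ← C_mul, inv_mul_cancel₀ (NeZero.ne 2), C_1, one_mul] at h₀
  exact Ideal.mem_span_singleton.1 (Ideal.Quotient.eq_zero_iff_mem.1 h₀)

/-- A polynomial alternating in the variables indexed by `Fin l` is divisible by their Vandermonde
product. -/
theorem prod_X_sub_X_dvd_of_alternating [NeZero (2 : K)] {l : ℕ} {τ : Type*}
    {f : MvPolynomial (Fin l ⊕ τ) K}
    (hf : ∀ i j : Fin l, i ≠ j → rename (Sum.map (Equiv.swap i j) id) f = -f) :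
    (∏ i : Fin l, ∏ j ∈ Finset.Ioi i, (X (Sum.inl i) - X (Sum.inl j))) ∣ f := by
  classical
  rw [Finset.prod_sigma']
  refine Finset.prod_dvd_of_isRelPrime ?_ ?_
  · rintro ⟨i, j⟩ hij ⟨i', j'⟩ hij' hne
    simp only [Finset.coe_sigma, Set.mem_sigma_iff, Finset.mem_coe, Finset.mem_univ,
      Finset.mem_Ioi, true_and] at hij hij'
    refine isRelPrime_X_sub_X (by simpa using hij.ne) (by simpa using hij'.ne) ?_
    simp only [ne_eq, Sum.inl.injEq]
    by_contra hcon
    refine hne ?_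
    obtain ⟨rfl, rfl⟩ : i = i' ∧ j = j' := by omega
    rfl
  · rintro ⟨i, j⟩ hij
    simp only [Finset.mem_sigma, Finset.mem_univ, Finset.mem_Ioi, true_and] at hij
    refine X_sub_X_dvd_of_rename_swap ?_
    rw [← hf i j hij.ne, ← Equiv.Perm.sumCongr_swap_one]
    rfl

/-- The alternating sum over permutations of the variables indexed by `Fin l` is divisible by
their Vandermonde product. -/
theorem prod_X_sub_X_dvd_sum_sign [NeZero (2 : K)] {l : ℕ} {τ : Type*}
    (g : MvPolynomial (Fin l ⊕ τ) K) :
    (∏ i : Fin l, ∏ j ∈ Finset.Ioi i, (X (Sum.inl i) - X (Sum.inl j))) ∣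
      ∑ ρ : Equiv.Perm (Fin l), (Equiv.Perm.sign ρ : ℤ) • rename (Sum.map ρ id) g := by
  refine prod_X_sub_X_dvd_of_alternating fun i j hij => ?_
  rw [map_sum, ← Finset.sum_neg_distrib]
  refine Fintype.sum_equiv (Equiv.mulLeft (Equiv.swap i j)) _ _ fun ρ => ?_
  rw [map_zsmul, rename_rename, Sum.map_comp_map, Equiv.coe_mulLeft, Equiv.Perm.sign_mul,
    Equiv.Perm.sign_swap hij, Equiv.Perm.coe_mul, Function.comp_id]
  simp

/-- A Laurent monomial times a polynomial is a Laurent polynomial, as functions on the torus. -/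
theorem exists_finsupp_sum_eq_prod_zpow_mul_eval [Fintype σ] (e : σ →₀ ℤ)
    (p : MvPolynomial σ K) :
    ∃ F : (σ →₀ ℤ) →₀ K, ∀ x : σ → K, (∀ i, x i ≠ 0) →
      F.sum (fun d c => c * ∏ i, x i ^ d i) = (∏ i, x i ^ e i) * eval x p := by
  induction p using MvPolynomial.induction_on' with
  | monomial n a =>
    refine ⟨Finsupp.single (e + n.mapRange (fun k : ℕ => (k : ℤ)) rfl) a, fun x hx => ?_⟩
    rw [Finsupp.sum_single_index (by simp), eval_monomial,
      Finsupp.prod_fintype _ _ (by simp), mul_left_comm, ← Finset.prod_mul_distrib]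
    congr 1
    refine Finset.prod_congr rfl fun i _ => ?_
    rw [Finsupp.add_apply, Finsupp.mapRange_apply, zpow_add₀ (hx i), zpow_natCast]
  | add p q hp hq =>
    obtain ⟨F, hF⟩ := hp
    obtain ⟨F', hF'⟩ := hq
    refine ⟨F + F', fun x hx => ?_⟩
    rw [Finsupp.sum_add_index' (by simp) (by intros; ring), hF x hx, hF' x hx, map_add, mul_add]

end MvPolynomial

/-- The point `(e^{πi t₁/κ},…,e^{πi t_l/κ}, e^{πi z/κ}, e^{πi m/κ})`. -/
noncomputable def expPoint (κ : ℂ) {l : ℕ} (t : Fin l → ℂ) (z m : ℂ) : Fin l ⊕ Fin 2 → ℂ :=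
  Sum.elim (fun u => Complex.exp ((π : ℂ) * Complex.I * t u / κ))
    ![Complex.exp ((π : ℂ) * Complex.I * z / κ), Complex.exp ((π : ℂ) * Complex.I * m / κ)]

/-- The point `(e^{2πi t₁/κ},…,e^{2πi t_l/κ}, e^{πi z/κ}, e^{πi m/κ})`. -/
noncomputable def expSqPoint (κ : ℂ) {l : ℕ} (t : Fin l → ℂ) (z m : ℂ) : Fin l ⊕ Fin 2 → ℂ :=
  Sum.elim (fun u => Complex.exp ((π : ℂ) * Complex.I * t u / κ) ^ 2)
    ![Complex.exp ((π : ℂ) * Complex.I * z / κ), Complex.exp ((π : ℂ) * Complex.I * m / κ)]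

/-- The polynomial in `e^{2πi t_u/κ}, e^{πi z/κ}, e^{πi m/κ}` underlying the `u`-th one-variable
factor of the summand of `PWeight`. -/
noncomputable def factorPoly {l : ℕ} (b : ℕ) (u : Fin l) : MvPolynomial (Fin l ⊕ Fin 2) ℂ :=
  MvPolynomial.C (2 * Complex.I)⁻¹ *
    if (u : ℕ) < l - b then
      MvPolynomial.X (Sum.inl u) * MvPolynomial.X (Sum.inr 1) ^ 2 - MvPolynomial.X (Sum.inr 0) ^ 2
    else
      MvPolynomial.X (Sum.inr 0) * MvPolynomial.X (Sum.inr 1) * (MvPolynomial.X (Sum.inl u) - 1)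

/-- The numerator of the summand of `PWeight`, in the variables of `expSqPoint`. -/
noncomputable def numeratorPoly (q : ℂ) {l : ℕ} (b : ℕ) : MvPolynomial (Fin l ⊕ Fin 2) ℂ :=
  (∏ u, factorPoly b u) * ∏ u : Fin l, ∏ v ∈ Finset.Ioi u,
    (MvPolynomial.C q⁻¹ * MvPolynomial.X (Sum.inl u) -
      MvPolynomial.C q * MvPolynomial.X (Sum.inl v))

theorem Complex.sin_eq_exp_div_exp (x : ℂ) :
    Complex.sin x =
      (Complex.exp (x * Complex.I) - (Complex.exp (x * Complex.I))⁻¹) / (2 * Complex.I) := by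
  rw [← Complex.exp_neg, Complex.sin, neg_mul, div_eq_div_iff two_ne_zero (by simp)]
  linear_combination 2 * (Complex.exp (-(x * Complex.I)) - Complex.exp (x * Complex.I)) *
    Complex.I_sq

theorem expSqPoint_comp_map (κ : ℂ) {l : ℕ} (t : Fin l → ℂ) (z m : ℂ) (σ : Equiv.Perm (Fin l)) :
    expSqPoint κ t z m ∘ Sum.map σ id = expSqPoint κ (t ∘ σ) z m := by
  funext i
  rcases i with u | k <;> rfl

theorem eval_factorPoly (κ : ℂ) {l : ℕ} (b : ℕ) (t : Fin l → ℂ) (z m : ℂ) (u : Fin l) :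
    (if (u : ℕ) < l - b then Complex.sin ((π : ℂ) * (t u - z + m) / κ)
      else Complex.sin ((π : ℂ) * t u / κ)) =
    (Complex.exp ((π : ℂ) * Complex.I * t u / κ) * Complex.exp ((π : ℂ) * Complex.I * z / κ) *
      Complex.exp ((π : ℂ) * Complex.I * m / κ))⁻¹ *
      MvPolynomial.eval (expSqPoint κ t z m) (factorPoly b u) := by
  have h₁ : Complex.exp ((π : ℂ) * (t u - z + m) / κ * Complex.I) =
      Complex.exp ((π : ℂ) * Complex.I * t u / κ) / Complex.exp ((π : ℂ) * Complex.I * z / κ) *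
        Complex.exp ((π : ℂ) * Complex.I * m / κ) := by
    rw [← Complex.exp_sub, ← Complex.exp_add]
    congr 1
    ring
  have h₂ : Complex.exp ((π : ℂ) * t u / κ * Complex.I) =
      Complex.exp ((π : ℂ) * Complex.I * t u / κ) := by
    congr 1
    ring
  rw [Complex.sin_eq_exp_div_exp, Complex.sin_eq_exp_div_exp, h₁, h₂]
  have hx := Complex.exp_ne_zero ((π : ℂ) * Complex.I * t u / κ)
  have hy := Complex.exp_ne_zero ((π : ℂ) * Complex.I * z / κ)
  have hw := Complex.exp_ne_zero ((π : ℂ) * Complex.I * m / κ)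
  split_ifs with h
  · simp only [factorPoly, if_pos h, expSqPoint, map_mul, map_sub, map_pow, MvPolynomial.eval_C,
      MvPolynomial.eval_X, Sum.elim_inl, Sum.elim_inr, Matrix.cons_val_zero, Matrix.cons_val_one]
    field_simp
  · simp only [factorPoly, if_neg h, expSqPoint, map_mul, map_sub, map_one, MvPolynomial.eval_C,
      MvPolynomial.eval_X, Sum.elim_inl, Sum.elim_inr, Matrix.cons_val_zero, Matrix.cons_val_one]
    field_simp

theorem sin_sub_one_div_sin (κ x y : ℂ) :
    Complex.sin ((π : ℂ) * (x - y - 1) / κ) / Complex.sin ((π : ℂ) * (x - y) / κ) =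
    ((Complex.exp ((π : ℂ) * Complex.I / κ))⁻¹ * Complex.exp ((π : ℂ) * Complex.I * x / κ) ^ 2 -
      Complex.exp ((π : ℂ) * Complex.I / κ) * Complex.exp ((π : ℂ) * Complex.I * y / κ) ^ 2) /
    (Complex.exp ((π : ℂ) * Complex.I * x / κ) ^ 2 -
      Complex.exp ((π : ℂ) * Complex.I * y / κ) ^ 2) := by
  have h₁ : Complex.exp ((π : ℂ) * (x - y - 1) / κ * Complex.I) =
      Complex.exp ((π : ℂ) * Complex.I * x / κ) / Complex.exp ((π : ℂ) * Complex.I * y / κ) /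
        Complex.exp ((π : ℂ) * Complex.I / κ) := by
    rw [← Complex.exp_sub, ← Complex.exp_sub]
    congr 1
    ring
  have h₂ : Complex.exp ((π : ℂ) * (x - y) / κ * Complex.I) =
      Complex.exp ((π : ℂ) * Complex.I * x / κ) / Complex.exp ((π : ℂ) * Complex.I * y / κ) := by
    rw [← Complex.exp_sub]
    congr 1
    ring
  rw [Complex.sin_eq_exp_div_exp, Complex.sin_eq_exp_div_exp, h₁, h₂]
  have hx := Complex.exp_ne_zero ((π : ℂ) * Complex.I * x / κ)
  have hy := Complex.exp_ne_zero ((π : ℂ) * Complex.I * y / κ)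
  have hq := Complex.exp_ne_zero ((π : ℂ) * Complex.I / κ)
  generalize Complex.exp ((π : ℂ) * Complex.I * x / κ) = X at *
  generalize Complex.exp ((π : ℂ) * Complex.I * y / κ) = Y at *
  generalize Complex.exp ((π : ℂ) * Complex.I / κ) = q at *
  have hc : (2 * Complex.I * X * Y)⁻¹ ≠ 0 := by simp [hx, hy]
  rw [← mul_div_mul_left _ (X ^ 2 - Y ^ 2) hc]
  congr 1
  · field_simp
  · field_simp

theorem exp_sq_sub_exp_sq_ne_zero {κ x y : ℂ} (h : ∀ n : ℤ, (x - y) / κ ≠ n) :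
    Complex.exp ((π : ℂ) * Complex.I * x / κ) ^ 2 -
      Complex.exp ((π : ℂ) * Complex.I * y / κ) ^ 2 ≠ 0 := by
  rw [sub_ne_zero, ← Complex.exp_nat_mul, ← Complex.exp_nat_mul, Ne,
    Complex.exp_eq_exp_iff_exists_int]
  rintro ⟨n, hn⟩
  refine h n (mul_left_cancel₀ Complex.two_pi_I_ne_zero ?_)
  push_cast at hn
  linear_combination hn

/-- The summand of `PWeight` as a rational function of exponentials. -/
theorem PWeight_summand_eq (κ : ℂ) {l : ℕ} (b : ℕ) (s : Fin l → ℂ) (z m : ℂ) :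
    (∏ u ∈ Finset.univ.filter (fun u : Fin l => (u : ℕ) < l - b),
        Complex.sin ((π : ℂ) * (s u - z + m) / κ)) *
    (∏ u ∈ Finset.univ.filter (fun u : Fin l => l - b ≤ (u : ℕ)),
        Complex.sin ((π : ℂ) * s u / κ)) *
    (∏ u, ∏ v ∈ Finset.Ioi u,
      Complex.sin ((π : ℂ) * (s u - s v - 1) / κ) / Complex.sin ((π : ℂ) * (s u - s v) / κ)) =
    (∏ u, (Complex.exp ((π : ℂ) * Complex.I * s u / κ) *
      Complex.exp ((π : ℂ) * Complex.I * z / κ) *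
      Complex.exp ((π : ℂ) * Complex.I * m / κ))⁻¹) *
    (MvPolynomial.eval (expSqPoint κ s z m)
        (numeratorPoly (Complex.exp ((π : ℂ) * Complex.I / κ)) b) /
      ∏ u, ∏ v ∈ Finset.Ioi u, (Complex.exp ((π : ℂ) * Complex.I * s u / κ) ^ 2 -
        Complex.exp ((π : ℂ) * Complex.I * s v / κ) ^ 2)) := by
  simp_rw [← not_lt (b := l - b), ← Finset.prod_ite, eval_factorPoly κ b s z m,
    sin_sub_one_div_sin, Finset.prod_div_distrib, Finset.prod_mul_distrib, numeratorPoly,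
    map_mul, map_prod, map_sub, map_mul, MvPolynomial.eval_C, MvPolynomial.eval_X, expSqPoint,
    Sum.elim_inl]
  ring

/-- `P_{l−b,b}(t,z;m)` is a trigonometric polynomial in `t₁,…,t_l, z, m`: it is given by
a Laurent polynomial (an element of `AddMonoidAlgebra ℂ ((Fin l ⊕ Fin 2) →₀ ℤ)`, here
presented as a finitely supported family of coefficients indexed by integer exponent
vectors) evaluated at `e^{πi t₁/κ},…,e^{πi t_l/κ}, e^{πi z/κ}, e^{πi m/κ}`. -/
theorem PWeight_is_trigonometric_polynomial
    (κ : ℂ) (hκ : κ ≠ 0) (l : ℕ) (hl : 0 < l) (b : ℕ) (hb : b ≤ l) :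
    ∃ F : ((Fin l ⊕ Fin 2) →₀ ℤ) →₀ ℂ,
      ∀ (t : Fin l → ℂ) (z m : ℂ),
        (∀ u v : Fin l, u ≠ v → ∀ n : ℤ, (t u - t v) / κ ≠ (n : ℂ)) →
        PWeight κ b t z m =
          F.sum (fun d c => c * ∏ i : Fin l ⊕ Fin 2,
            (Sum.elim (fun u => Complex.exp ((π : ℂ) * Complex.I * t u / κ))
              ![Complex.exp ((π : ℂ) * Complex.I * z / κ),
                Complex.exp ((π : ℂ) * Complex.I * m / κ)] i) ^ (d i)) := by
  set q := Complex.exp ((π : ℂ) * Complex.I / κ)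
  obtain ⟨Q, hQ⟩ := MvPolynomial.prod_X_sub_X_dvd_sum_sign (numeratorPoly (l := l) q b)
  obtain ⟨F, hF⟩ := MvPolynomial.exists_finsupp_sum_eq_prod_zpow_mul_eval
    (Finsupp.equivFunOnFinite.symm
      (Sum.elim (fun _ => -1) ![(b : ℤ) - l, -l] : Fin l ⊕ Fin 2 → ℤ))
    (MvPolynomial.bind₁ (Sum.elim (fun u => MvPolynomial.X (Sum.inl u) ^ 2)
      (fun k => MvPolynomial.X (Sum.inr k))) Q)
  refine ⟨F, fun t z m ht => ?_⟩
  have hpt : ∀ i, expPoint κ t z m i ≠ 0 := by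
    rintro (u | k)
    · exact Complex.exp_ne_zero _
    · fin_cases k <;> exact Complex.exp_ne_zero _
  have hsq : MvPolynomial.eval (expPoint κ t z m) (MvPolynomial.bind₁
      (Sum.elim (fun u => MvPolynomial.X (Sum.inl u) ^ 2)
        (fun k => MvPolynomial.X (Sum.inr k))) Q) =
      MvPolynomial.eval (expSqPoint κ t z m) Q := by
    rw [MvPolynomial.eval, MvPolynomial.eval₂Hom_bind₁]
    congr 2
    funext i
    rcases i with u | k <;> simp [expPoint, expSqPoint]
  have hQt := congrArg (MvPolynomial.eval (expSqPoint κ t z m)) hQ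
  simp only [map_sum, map_zsmul, MvPolynomial.eval_rename, expSqPoint_comp_map, map_mul, map_prod,
    map_sub, MvPolynomial.eval_X] at hQt
  have hV : (∏ u, ∏ v ∈ Finset.Ioi u, (Complex.exp ((π : ℂ) * Complex.I * t u / κ) ^ 2 -
      Complex.exp ((π : ℂ) * Complex.I * t v / κ) ^ 2)) ≠ 0 :=
    Finset.prod_ne_zero_iff.2 fun u _ => Finset.prod_ne_zero_iff.2 fun v hv =>
      exp_sq_sub_exp_sq_ne_zero (ht u v (Finset.mem_Ioi.1 hv).ne)
  refine Eq.trans ?_ (hF (expPoint κ t z m) hpt).symm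
  rw [hsq, PWeight, SymSum]
  simp_rw [PWeight_summand_eq]
  have hterm : ∀ σ : Equiv.Perm (Fin l),
      (∏ u, (Complex.exp ((π : ℂ) * Complex.I * (t ∘ σ) u / κ) *
        Complex.exp ((π : ℂ) * Complex.I * z / κ) *
        Complex.exp ((π : ℂ) * Complex.I * m / κ))⁻¹) *
      (MvPolynomial.eval (expSqPoint κ (t ∘ σ) z m) (numeratorPoly q b) /
        ∏ u, ∏ v ∈ Finset.Ioi u, (Complex.exp ((π : ℂ) * Complex.I * (t ∘ σ) u / κ) ^ 2 -
          Complex.exp ((π : ℂ) * Complex.I * (t ∘ σ) v / κ) ^ 2)) =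
      (∏ u, (Complex.exp ((π : ℂ) * Complex.I * t u / κ) *
        Complex.exp ((π : ℂ) * Complex.I * z / κ) *
        Complex.exp ((π : ℂ) * Complex.I * m / κ))⁻¹) *
      (((Equiv.Perm.sign σ : ℤ) •
        MvPolynomial.eval (expSqPoint κ (t ∘ σ) z m) (numeratorPoly q b)) /
        ∏ u, ∏ v ∈ Finset.Ioi u, (Complex.exp ((π : ℂ) * Complex.I * t u / κ) ^ 2 -
          Complex.exp ((π : ℂ) * Complex.I * t v / κ) ^ 2)) := by
    intro σ
    have hs := σ.prod_Ioi_comp_eq_sign_mul_prod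
      (f := fun u v => Complex.exp ((π : ℂ) * Complex.I * t u / κ) ^ 2 -
        Complex.exp ((π : ℂ) * Complex.I * t v / κ) ^ 2) fun _ _ => (neg_sub _ _).symm
    have hp := Equiv.prod_comp σ (fun u => (Complex.exp ((π : ℂ) * Complex.I * t u / κ) *
        Complex.exp ((π : ℂ) * Complex.I * z / κ) *
        Complex.exp ((π : ℂ) * Complex.I * m / κ))⁻¹)
    simp only [Function.comp_apply] at hs hp ⊢
    rw [hs, hp]
    rcases Int.units_eq_one_or (Equiv.Perm.sign σ) with h | h <;> simp [h, neg_div, div_neg]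
  have hQ' : (∑ σ : Equiv.Perm (Fin l), (Equiv.Perm.sign σ : ℤ) •
        MvPolynomial.eval (expSqPoint κ (t ∘ σ) z m) (numeratorPoly q b)) /
      (∏ u, ∏ v ∈ Finset.Ioi u, (Complex.exp ((π : ℂ) * Complex.I * t u / κ) ^ 2 -
        Complex.exp ((π : ℂ) * Complex.I * t v / κ) ^ 2)) =
      MvPolynomial.eval (expSqPoint κ t z m) Q := by
    rw [hQt, div_eq_iff hV, mul_comm]
    rfl
  rw [Finset.sum_congr rfl fun σ _ => hterm σ, ← Finset.mul_sum, ← Finset.sum_div, hQ',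
    ← mul_assoc]
  congr 1
  have hb' : Complex.exp ((π : ℂ) * Complex.I * (b : ℂ) * z / κ) =
      Complex.exp ((π : ℂ) * Complex.I * z / κ) ^ b := by
    rw [← Complex.exp_nat_mul]
    congr 1
    ring
  rw [hb']
  simp only [Fintype.prod_sum_type, Fin.prod_univ_two, expPoint,
    Finsupp.equivFunOnFinite_symm_apply_apply, Sum.elim_inl, Sum.elim_inr, Matrix.cons_val_zero, Matrix.cons_val_one, mul_inv,
    Finset.prod_mul_distrib, Finset.prod_const, Finset.card_univ, Fintype.card_fin, zpow_one,
    zpow_neg, zpow_natCast, zpow_sub₀ (Complex.exp_ne_zero _)]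
  ring
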